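/- Let d ≥ 3. For every η ∈ (0,1) and every ε > 0 there exists L > 0, depending only on η, ε and d, such that for every past matrix N (i.e., every finite product of the matrices B₁ and B₂, including the identity): p({v ∈ Ω₁ : there exists i ≥ 0 with (S^i(v))[1] < ε·v[1] and C_max(N·M(v,i)) ≤ L·C_max(N)} | N) ≥ η. In words: with conditional probability at least η the first coordinate drops below ε times its initial value before the largest column sum increases by a factor of L. -/

import Mathlib

open MeasureTheory

noncomputable section

/-- The cone `Ω = {x ∈ ℝ^d : 0 ≤ x[1] ≤ … ≤ x[d] ≤ x[1]+x[2]}` intersected with the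
hyperplane `{x : x[1]+⋯+x[d] = 1}`, i.e. `Ω₁`, for `d = m + 3`, inside Euclidean space. -/
def selmerSimplexE (m : ℕ) : Set (EuclideanSpace ℝ (Fin (m + 3))) :=
  {x | 0 ≤ x 0 ∧ (∀ i j : Fin (m + 3), i ≤ j → x i ≤ x j) ∧
    x (Fin.last (m + 2)) ≤ x 0 + x 1 ∧ ∑ i, x i = 1}

/-- The restricted Selmer map `S : Ω → Ω`:
`S(x) = (x[1], x[d]−x[1], x[2], …, x[d−1])` if `x[d] ≥ 2x[1]`, and
`S(x) = (x[d]−x[1], x[1], x[2], …, x[d−1])` otherwise. -/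
def selmerS (m : ℕ) (x : Fin (m + 3) → ℝ) : Fin (m + 3) → ℝ := fun i =>
  if (i : ℕ) = 0 then
    (if 2 * x 0 ≤ x (Fin.last (m + 2)) then x 0 else x (Fin.last (m + 2)) - x 0)
  else if (i : ℕ) = 1 then
    (if 2 * x 0 ≤ x (Fin.last (m + 2)) then x (Fin.last (m + 2)) - x 0 else x 0)
  else x ⟨(i : ℕ) - 1, by have := i.isLt; omega⟩

/-- The matrix `B₁`, acting by `B₁y = (y[1], y[3], y[4], …, y[d], y[1]+y[2])`, so that
`B₁·S(x) = x` when `x[d] ≥ 2x[1]`. -/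
def selmerB1 (m : ℕ) : Matrix (Fin (m + 3)) (Fin (m + 3)) ℝ :=
  Matrix.of fun i j =>
    if (i : ℕ) = 0 then (if (j : ℕ) = 0 then 1 else 0)
    else if (i : ℕ) = m + 2 then (if (j : ℕ) ≤ 1 then 1 else 0)
    else if (j : ℕ) = (i : ℕ) + 1 then 1 else 0

/-- The matrix `B₂`, acting by `B₂y = (y[2], y[3], y[4], …, y[d], y[1]+y[2])`, so that
`B₂·S(x) = x` when `x[d] < 2x[1]`. -/
def selmerB2 (m : ℕ) : Matrix (Fin (m + 3)) (Fin (m + 3)) ℝ :=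
  Matrix.of fun i j =>
    if (i : ℕ) = 0 then (if (j : ℕ) = 1 then 1 else 0)
    else if (i : ℕ) = m + 2 then (if (j : ℕ) ≤ 1 then 1 else 0)
    else if (j : ℕ) = (i : ℕ) + 1 then 1 else 0

/-- The one-step matrix `B_{ι(x)}`, where `ι(x) = 1` if `x[d] ≥ 2x[1]` and `ι(x) = 2`
otherwise. -/
def selmerStep (m : ℕ) (x : Fin (m + 3) → ℝ) : Matrix (Fin (m + 3)) (Fin (m + 3)) ℝ :=
  if 2 * x 0 ≤ x (Fin.last (m + 2)) then selmerB1 m else selmerB2 m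

/-- The matrix of induction `M(x,n) = B_{ι(x)}·B_{ι(S(x))}···B_{ι(S^{n−1}(x))}`
(with `M(x,0) = Id`), so that `M(x,n)·Sⁿ(x) = x`. -/
def selmerMat (m : ℕ) (x : Fin (m + 3) → ℝ) : ℕ → Matrix (Fin (m + 3)) (Fin (m + 3)) ℝ
  | 0 => 1
  | n + 1 => selmerMat m x n * selmerStep m ((selmerS m)^[n] x)

/-- The `j`-th column sum `C_j(N)` of a matrix. -/
def colSum (m : ℕ) (N : Matrix (Fin (m + 3)) (Fin (m + 3)) ℝ) (j : Fin (m + 3)) : ℝ :=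
  ∑ i, N i j

/-- The largest column sum `C_max(N)` of a matrix. -/
def colMax (m : ℕ) (N : Matrix (Fin (m + 3)) (Fin (m + 3)) ℝ) : ℝ :=
  ⨆ j, colSum m N j

/-- `N` is `β`-balanced if `β·C_j(N) ≥ C_max(N)` for every `j`. -/
def IsBalanced (m : ℕ) (β : ℝ) (N : Matrix (Fin (m + 3)) (Fin (m + 3)) ℝ) : Prop :=
  ∀ j, colMax m N ≤ β * colSum m N j

/-- The conditional probability of `U ⊆ Ω₁` given the past matrix `N`:
`p(U|N) = (∫_U (C₁v[1]+⋯+C_d v[d])^{−d} dλ₀) / (∫_{Ω₁} (C₁v[1]+⋯+C_d v[d])^{−d} dλ₀)`,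
where `C_j = C_j(N)` and `λ₀` is the `(d−1)`-dimensional Hausdorff measure. -/
def selmerCondP (m : ℕ) (N : Matrix (Fin (m + 3)) (Fin (m + 3)) ℝ)
    (U : Set (EuclideanSpace ℝ (Fin (m + 3)))) : ℝ :=
  (∫ v in U, ((∑ j, colSum m N j * v j) ^ (m + 3))⁻¹ ∂(μH[(m + 2 : ℝ)])) /
    (∫ v in selmerSimplexE m, ((∑ j, colSum m N j * v j) ^ (m + 3))⁻¹ ∂(μH[(m + 2 : ℝ)]))

end

def InCone (m : ℕ) (x : Fin (m+3) → ℝ) : Prop :=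
  0 ≤ x 0 ∧ (∀ i j : Fin (m + 3), i ≤ j → x i ≤ x j) ∧ x (Fin.last (m + 2)) ≤ x 0 + x 1

lemma selmerS_zero (m : ℕ) (x : Fin (m+3) → ℝ) : selmerS m x 0 =
    (if 2 * x 0 ≤ x (Fin.last (m + 2)) then x 0 else x (Fin.last (m + 2)) - x 0) := by
  simp [selmerS]

lemma selmerS_one (m : ℕ) (x : Fin (m+3) → ℝ) : selmerS m x 1 =
    (if 2 * x 0 ≤ x (Fin.last (m + 2)) then x (Fin.last (m + 2)) - x 0 else x 0) := by
  simp [selmerS]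

lemma selmerS_succ (m : ℕ) (x : Fin (m+3) → ℝ) (k : Fin (m+3)) (hk : (k:ℕ) ≠ 0)
    (hk' : (k:ℕ) + 1 < m + 3) : selmerS m x ⟨k+1, hk'⟩ = x k := by
  simp [selmerS, hk]

lemma cone_S (m : ℕ) (x : Fin (m+3) → ℝ) (h : InCone m x) : InCone m (selmerS m x) := by
  obtain ⟨h0, hm, hl⟩ := h
  have h01 := hm 0 1 (Fin.zero_le _)
  have h0l := hm 0 (Fin.last _) (Fin.zero_le _)
  have hlast : selmerS m x (Fin.last (m+2)) = x ⟨m+1, by omega⟩ := by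
    have := selmerS_succ m x ⟨m+1, by omega⟩ (by simp) (by simp)
    exact this
  have h2 : ∀ i : Fin (m+3), (i:ℕ) ≠ 0 → (i:ℕ) ≠ 1 →
      selmerS m x i = x ⟨(i : ℕ) - 1, by have := i.isLt; omega⟩ := by
    intro i hi hi1
    simp [selmerS, hi, hi1]
  have hS0 := selmerS_zero m x
  have hS1 := selmerS_one m x
  have hS01 : selmerS m x 0 ≤ selmerS m x 1 := by
    rw [hS0, hS1]; split_ifs <;> linarith
  have hS0n : 0 ≤ selmerS m x 0 := by
    rw [hS0]; split_ifs <;> linarith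
  have hS12 : selmerS m x 1 ≤ x 1 := by
    rw [hS1]; split_ifs <;> linarith
  refine ⟨hS0n, ?_, ?_⟩
  · intro i j hij
    have hij' : (i:ℕ) ≤ j := hij
    by_cases hj0 : (j:ℕ) = 0
    · have : i = j := Fin.ext (by omega)
      rw [this]
    by_cases hj1 : (j:ℕ) = 1
    · have hj : j = 1 := Fin.ext (by simpa using hj1)
      by_cases hi0 : (i:ℕ) = 0
      · have hi : i = 0 := Fin.ext (by simpa using hi0)
        rw [hi, hj]; exact hS01
      · have : i = j := Fin.ext (by omega)
        rw [this]
    rw [h2 j hj0 hj1]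
    have hb : x 1 ≤ x ⟨(j : ℕ) - 1, by have := j.isLt; omega⟩ := by
      apply hm; rw [Fin.le_def]; simp; omega
    by_cases hi0 : (i:ℕ) = 0
    · have hi : i = 0 := Fin.ext (by simpa using hi0)
      rw [hi]; linarith
    by_cases hi1 : (i:ℕ) = 1
    · have hi : i = 1 := Fin.ext (by simpa using hi1)
      rw [hi]; linarith
    rw [h2 i hi0 hi1]
    apply hm; rw [Fin.le_def]; simp; omega
  · rw [hlast]
    have : x ⟨m+1, by omega⟩ ≤ x (Fin.last _) := hm _ _ (Fin.le_last _)
    have hs : selmerS m x 0 + selmerS m x 1 = x (Fin.last _) := by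
      rw [hS0, hS1]; split_ifs <;> ring
    linarith

/-- The properties of the step matrices. -/
lemma step_nonneg (m : ℕ) (B : Matrix (Fin (m+3)) (Fin (m+3)) ℝ)
    (hB : B = selmerB1 m ∨ B = selmerB2 m) (i j) : 0 ≤ B i j := by
  rcases hB with rfl | rfl <;> simp only [selmerB1, selmerB2, Matrix.of_apply] <;> split_ifs <;>
    norm_num

lemma step_one (m : ℕ) (B : Matrix (Fin (m+3)) (Fin (m+3)) ℝ)
    (hB : B = selmerB1 m ∨ B = selmerB2 m) (j : Fin (m+3)) : ∃ i, B i j = 1 := by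
  by_cases hj : (j:ℕ) ≤ 1
  · refine ⟨Fin.last _, ?_⟩
    rcases hB with rfl | rfl <;> simp [selmerB1, selmerB2, hj]
  · refine ⟨⟨(j:ℕ) - 1, by have := j.isLt; omega⟩, ?_⟩
    have h1 : ¬ ((j:ℕ) - 1 = 0) := by omega
    have h2 : ¬ ((j:ℕ) - 1 = m + 2) := by have := j.isLt; omega
    have h3 : (j:ℕ) = (j:ℕ) - 1 + 1 := by omega
    rcases hB with rfl | rfl <;> simp only [selmerB1, selmerB2, Matrix.of_apply] <;>
      rw [if_neg h1, if_neg h2, if_pos h3]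

lemma step_sum (m : ℕ) (B : Matrix (Fin (m+3)) (Fin (m+3)) ℝ)
    (hB : B = selmerB1 m ∨ B = selmerB2 m) (j : Fin (m+3)) : ∑ i, B i j ≤ 3 := by
  have key : ∀ i, B i j ≤ (if i = 0 then 1 else 0) + (if i = Fin.last (m+2) then 1 else 0)
      + (if i = ⟨(j:ℕ) - 1, by have := j.isLt; omega⟩ then 1 else 0) := by
    intro i
    by_cases h1 : i = 0
    · have : B i j ≤ 1 := by
        rcases hB with rfl | rfl <;> simp only [selmerB1, selmerB2, Matrix.of_apply] <;>
          split_ifs <;> norm_num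
      rw [if_pos h1]
      split_ifs <;> linarith
    by_cases h2 : i = Fin.last (m+2)
    · have : B i j ≤ 1 := by
        rcases hB with rfl | rfl <;> simp only [selmerB1, selmerB2, Matrix.of_apply] <;>
          split_ifs <;> norm_num
      rw [if_neg h1, if_pos h2]
      split_ifs <;> linarith
    have h1' : ¬ ((i:ℕ) = 0) := fun h => h1 (Fin.ext (by simpa using h))
    have h2' : ¬ ((i:ℕ) = m+2) := fun h => h2 (Fin.ext (by simpa using h))
    rw [if_neg h1, if_neg h2]
    by_cases h3 : (j:ℕ) = i + 1
    · have : i = ⟨(j:ℕ) - 1, by have := j.isLt; omega⟩ := Fin.ext (by simp; omega)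
      rw [if_pos this]
      rcases hB with rfl | rfl <;> simp [selmerB1, selmerB2, h1', h2', h3, h1]
    · have : B i j = 0 := by
        rcases hB with rfl | rfl <;> simp [selmerB1, selmerB2, h1', h2', h3, h1]
      rw [this]; split_ifs <;> norm_num
  refine (Finset.sum_le_sum fun i _ => key i).trans ?_
  rw [Finset.sum_add_distrib, Finset.sum_add_distrib]
  simp only [Finset.sum_ite_eq', Finset.mem_univ, if_true]
  norm_num

lemma step_cases (m : ℕ) (x : Fin (m+3) → ℝ) :
    selmerStep m x = selmerB1 m ∨ selmerStep m x = selmerB2 m := by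
  unfold selmerStep; split_ifs <;> simp

lemma sum01 (m : ℕ) (y : Fin (m+3) → ℝ) :
    ∑ j : Fin (m+3), (if (j:ℕ) ≤ 1 then (1:ℝ) else 0) * y j = y 0 + y 1 := by
  rw [Fin.sum_univ_succ, Fin.sum_univ_succ]
  simp

lemma step_mul_S (m : ℕ) (x : Fin (m+3) → ℝ) (i : Fin (m+3)) :
    ∑ j, selmerStep m x i j * selmerS m x j = x i := by
  have hS0 := selmerS_zero m x
  have hS1 := selmerS_one m x
  by_cases h0 : (i:ℕ) = 0
  · have hi : i = 0 := Fin.ext (by simpa using h0)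
    subst hi
    unfold selmerStep
    split_ifs with hc
    · rw [Finset.sum_eq_single 0]
      · rw [hS0, if_pos hc]; simp [selmerB1]
      · intro b _ hb; simp [selmerB1, hb]
      · simp
    · rw [Finset.sum_eq_single 1]
      · rw [hS1, if_neg hc]; simp [selmerB2]
      · intro b _ hb
        have : ¬ ((b:ℕ) = 1) := fun h => hb (Fin.ext (by simpa using h))
        simp [selmerB2, this]
      · simp
  by_cases hl : (i:ℕ) = m + 2
  · have hi : i = Fin.last _ := Fin.ext (by simpa using hl)
    have : ∀ j, selmerStep m x i j = if (j:ℕ) ≤ 1 then 1 else 0 := by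
      intro j
      rcases step_cases m x with h | h <;> rw [h] <;>
        simp only [selmerB1, selmerB2, Matrix.of_apply] <;> rw [if_neg h0, if_pos hl]
    simp_rw [this]
    rw [sum01, hS0, hS1, hi]
    split_ifs <;> ring
  · have hlt : (i:ℕ) + 1 < m + 3 := by have := i.isLt; omega
    have : ∀ j : Fin (m+3), selmerStep m x i j = if j = ⟨i+1, hlt⟩ then 1 else 0 := by
      intro j
      rcases step_cases m x with h | h <;> rw [h] <;>
        simp only [selmerB1, selmerB2, Matrix.of_apply] <;> rw [if_neg h0, if_neg hl] <;>
        simp [Fin.ext_iff]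
    simp_rw [this]
    simp only [ite_mul, one_mul, zero_mul, Finset.sum_ite_eq', Finset.mem_univ, if_true]
    exact selmerS_succ m x i h0 hlt

lemma colSum_mul (m : ℕ) (N B : Matrix (Fin (m+3)) (Fin (m+3)) ℝ) (j) :
    colSum m (N * B) j = ∑ k, colSum m N k * B k j := by
  simp only [colSum, Matrix.mul_apply, Finset.sum_mul]
  rw [Finset.sum_comm]

lemma colSum_inv_step (m : ℕ) (N : Matrix (Fin (m+3)) (Fin (m+3)) ℝ) (x : Fin (m+3) → ℝ) :
    ∑ j, colSum m (N * selmerStep m x) j * selmerS m x j = ∑ j, colSum m N j * x j := by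
  simp only [colSum_mul, Finset.sum_mul]
  rw [Finset.sum_comm]
  refine Finset.sum_congr rfl fun k _ => ?_
  rw [← step_mul_S m x k, Finset.mul_sum]
  exact Finset.sum_congr rfl fun j _ => by ring

lemma colSum_inv (m : ℕ) (N : Matrix (Fin (m+3)) (Fin (m+3)) ℝ) (x : Fin (m+3) → ℝ) (n : ℕ) :
    ∑ j, colSum m (N * selmerMat m x n) j * (selmerS m)^[n] x j = ∑ j, colSum m N j * x j := by
  induction n with
  | zero => simp [selmerMat]
  | succ n ih =>
    rw [← ih, selmerMat, ← Matrix.mul_assoc, Function.iterate_succ_apply', colSum_inv_step]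

lemma colSum_le_max (m : ℕ) (N : Matrix (Fin (m+3)) (Fin (m+3)) ℝ) (j) :
    colSum m N j ≤ colMax m N :=
  le_ciSup (Set.finite_range _).bddAbove j

lemma step_pos (m : ℕ) (N B : Matrix (Fin (m+3)) (Fin (m+3)) ℝ)
    (hB : B = selmerB1 m ∨ B = selmerB2 m) (hN : ∀ j, 0 < colSum m N j) (j) :
    0 < colSum m (N * B) j := by
  rw [colSum_mul]
  obtain ⟨i, hi⟩ := step_one m B hB j
  refine Finset.sum_pos' (fun k _ => mul_nonneg (hN k).le (step_nonneg m B hB k j))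
    ⟨i, Finset.mem_univ _, ?_⟩
  rw [hi, mul_one]; exact hN i

lemma step_max (m : ℕ) (N B : Matrix (Fin (m+3)) (Fin (m+3)) ℝ)
    (hB : B = selmerB1 m ∨ B = selmerB2 m) (hN : ∀ j, 0 < colSum m N j) :
    colMax m (N * B) ≤ 3 * colMax m N := by
  refine ciSup_le fun j => ?_
  have h0 : 0 ≤ colMax m N := (hN 0).le.trans (colSum_le_max m N 0)
  rw [colSum_mul]
  calc ∑ k, colSum m N k * B k j ≤ ∑ k, colMax m N * B k j :=
        Finset.sum_le_sum fun k _ =>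
          mul_le_mul_of_nonneg_right (colSum_le_max m N k) (step_nonneg m B hB k j)
    _ = colMax m N * ∑ k, B k j := by rw [Finset.mul_sum]
    _ ≤ colMax m N * 3 := mul_le_mul_of_nonneg_left (step_sum m B hB j) h0
    _ = _ := by ring

lemma colSum_pos_mat (m : ℕ) (N : Matrix (Fin (m+3)) (Fin (m+3)) ℝ) (x : Fin (m+3) → ℝ)
    (hN : ∀ j, 0 < colSum m N j) (n : ℕ) : ∀ j, 0 < colSum m (N * selmerMat m x n) j := by
  induction n with
  | zero => simpa [selmerMat] using hN
  | succ n ih =>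
    rw [selmerMat, ← Matrix.mul_assoc]
    exact step_pos m _ _ (step_cases m _) ih

lemma colSum_pos_of_mem (m : ℕ) (N : Matrix (Fin (m+3)) (Fin (m+3)) ℝ)
    (hN : N ∈ Submonoid.closure {selmerB1 m, selmerB2 m}) : ∀ j, 0 < colSum m N j := by
  induction hN using Submonoid.closure_induction_right with
  | one => intro j; simp [colSum, Matrix.one_apply]
  | mul_right x hx y hy ih => exact step_pos m _ _ (by simpa using hy) ih

lemma cone_iter (m : ℕ) (x : Fin (m+3) → ℝ) (h : InCone m x) (n : ℕ) :
    InCone m ((selmerS m)^[n] x) := by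
  induction n with
  | zero => simpa using h
  | succ n ih => rw [Function.iterate_succ_apply']; exact cone_S m _ ih

lemma sum_S (m : ℕ) (x : Fin (m+3) → ℝ) : ∑ i, selmerS m x i = ∑ i, x i - x 0 := by
  rw [Fin.sum_univ_succ, Fin.sum_univ_succ, Fin.sum_univ_castSucc (f := x),
    Fin.sum_univ_succ (fun i : Fin (m+2) => x i.castSucc)]
  have hS0 := selmerS_zero m x
  have hS1 := selmerS_one m x
  have hs : selmerS m x 0 + selmerS m x 1 = x (Fin.last _) := by
    rw [hS0, hS1]; split_ifs <;> ring
  have h2 : ∀ i : Fin (m+1), selmerS m x i.succ.succ = x i.succ.castSucc := by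
    intro i
    simp only [selmerS, Fin.val_succ]
    rw [if_neg (by omega), if_neg (by omega)]
    congr 1
  simp only [h2]
  have : (Fin.succ (0 : Fin (m+2))) = 1 := rfl
  rw [this]
  have : (Fin.castSucc (0 : Fin (m+2))) = 0 := rfl
  rw [this]
  linarith

/-- The first coordinate eventually drops. -/
lemma exists_drop (m : ℕ) (x : Fin (m+3) → ℝ) (h : InCone m x) (a : ℝ) (ha : 0 < a) :
    ∃ i, ((selmerS m)^[i] x) 0 < a := by
  by_contra! hc
  have key : ∀ n : ℕ, ∑ i, ((selmerS m)^[n] x) i ≤ ∑ i, x i - n * a := by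
    intro n
    induction n with
    | zero => simp
    | succ n ih =>
      rw [Function.iterate_succ_apply', sum_S]
      have := hc n
      push_cast; linarith
  obtain ⟨n, hn⟩ := exists_nat_gt ((∑ i, x i) / a)
  rw [div_lt_iff₀ ha] at hn
  have h1 := key n
  have hcone := cone_iter m x h n
  have h2 : 0 ≤ ∑ i, ((selmerS m)^[n] x) i :=
    Finset.sum_nonneg fun i _ => hcone.1.trans (hcone.2.1 0 i (Fin.zero_le _))
  linarith

/-- Deterministic part. -/
lemma good_subset (m : ℕ) (N : Matrix (Fin (m+3)) (Fin (m+3)) ℝ) (hN : ∀ j, 0 < colSum m N j)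
    (ε K : ℝ) (hε : 0 < ε) (hK : 0 < K) (v : Fin (m+3) → ℝ) (hv : InCone m v) (hv0 : 0 < v 0)
    (hgood : ∑ j, colSum m N j * v j ≤ K * colMax m N * v 0) :
    ∃ i : ℕ, ((selmerS m)^[i] v) 0 < ε * v 0 ∧
        colMax m (N * selmerMat m v i) ≤ (1 + 3 * K / ε) * colMax m N := by
  classical
  have hX : 0 < colMax m N := (hN 0).trans_le (colSum_le_max m N 0)
  have hex := exists_drop m v hv (ε * v 0) (by positivity)
  have hspec := Nat.find_spec hex
  refine ⟨Nat.find hex, hspec, ?_⟩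
  rcases hi : Nat.find hex with _ | k
  · simp only [selmerMat, mul_one]
    have : 0 ≤ 3 * K / ε * colMax m N := by positivity
    linarith
  · have hk : ¬ _ := Nat.find_min hex (m := k) (by omega)
    push Not at hk
    have hpos := colSum_pos_mat m N v hN k
    have hcone := cone_iter m v hv k
    have hinv := colSum_inv m N v k
    have hmax : colMax m (N * selmerMat m v k) ≤ K / ε * colMax m N := by
      refine ciSup_le fun j => ?_
      have h1 : colSum m (N * selmerMat m v k) j * (ε * v 0) ≤
          ∑ j, colSum m (N * selmerMat m v k) j * (selmerS m)^[k] v j := by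
        refine le_trans ?_ (Finset.single_le_sum (f := fun j =>
          colSum m (N * selmerMat m v k) j * (selmerS m)^[k] v j) (fun i _ => ?_)
          (Finset.mem_univ j))
        · exact mul_le_mul_of_nonneg_left (hk.trans (hcone.2.1 0 j (Fin.zero_le _))) (hpos j).le
        · exact mul_nonneg (hpos i).le (hcone.1.trans (hcone.2.1 0 i (Fin.zero_le _)))
      rw [hinv] at h1
      have h2 := h1.trans hgood
      have h3 : colSum m (N * selmerMat m v k) j * ε ≤ K * colMax m N := by
        refine le_of_mul_le_mul_right ?_ hv0
        linarith
      rw [div_mul_eq_mul_div, le_div_iff₀ hε]; exact h3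
    rw [selmerMat, ← Matrix.mul_assoc]
    have := step_max m _ _ (step_cases m ((selmerS m)^[k] v)) hpos
    have e : (1 + 3 * K / ε) * colMax m N = colMax m N + 3 * (K / ε * colMax m N) := by ring
    rw [e]; linarith

/-- Linear section used to parametrize the hyperplane. -/
def secLin (m : ℕ) : (Fin (m+2) → ℝ) →ₗ[ℝ] EuclideanSpace ℝ (Fin (m+3)) where
  toFun y := WithLp.toLp 2 (Fin.cons (-∑ i, y i) y)
  map_add' x y := by
    ext i
    refine Fin.cases ?_ (fun j => ?_) i
    · simp [Finset.sum_add_distrib]; ring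
    · simp
  map_smul' a x := by
    ext i
    refine Fin.cases ?_ (fun j => ?_) i
    · simp [Finset.mul_sum]
    · simp

/-- The first basis vector. -/
def baseE (m : ℕ) : EuclideanSpace ℝ (Fin (m+3)) := WithLp.toLp 2 (Fin.cons 1 0)

/-- Forgetting the first coordinate. -/
def projLin (m : ℕ) : EuclideanSpace ℝ (Fin (m+3)) →ₗ[ℝ] (Fin (m+2) → ℝ) where
  toFun v := fun j => v j.succ
  map_add' x y := by ext i; simp
  map_smul' a x := by ext i; simp

lemma simplex_ge {m : ℕ} {v : EuclideanSpace ℝ (Fin (m+3))} (hv : v ∈ selmerSimplexE m)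
    (j : Fin (m+3)) : 0 ≤ v j := hv.1.trans (hv.2.1 0 j (Fin.zero_le _))

lemma simplex_le {m : ℕ} {v : EuclideanSpace ℝ (Fin (m+3))} (hv : v ∈ selmerSimplexE m)
    (j : Fin (m+3)) : v j ≤ 1 := by
  rw [← hv.2.2.2]
  exact Finset.single_le_sum (f := fun j => v j) (fun i _ => simplex_ge hv i) (Finset.mem_univ j)

lemma simplex_succ {m : ℕ} {v : EuclideanSpace ℝ (Fin (m+3))} (hv : v ∈ selmerSimplexE m)
    (j : Fin (m+2)) : 1 / (2 * (m + 3 : ℝ)) ≤ v j.succ := by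
  have h1 : (1:ℝ) ≤ (m+3) * v (Fin.last _) := by
    rw [← hv.2.2.2]
    calc ∑ i, v i ≤ ∑ i : Fin (m+3), v (Fin.last _) :=
          Finset.sum_le_sum fun i _ => hv.2.1 _ _ (Fin.le_last _)
      _ = _ := by simp
  have h2 := hv.2.2.1
  have h3 := hv.2.1 0 1 (Fin.zero_le _)
  have h4 : v 1 ≤ v j.succ := hv.2.1 _ _ (by rw [Fin.le_def]; simp)
  rw [div_le_iff₀ (by positivity)]
  have hm : (0:ℝ) < m + 3 := by positivity
  nlinarith

lemma simplex_finite (m : ℕ) : μH[(m + 2 : ℝ)] (selmerSimplexE m) < ⊤ := by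
  have hlip : LipschitzWith ‖(LinearMap.toContinuousLinearMap (secLin m))‖₊
      (fun y => baseE m + secLin m y) := by
    refine LipschitzWith.of_dist_le_mul fun x y => ?_
    rw [dist_add_left]
    exact (LinearMap.toContinuousLinearMap (secLin m)).lipschitz.dist_le_mul x y
  have hsub : selmerSimplexE m ⊆ (fun y => baseE m + secLin m y) '' (Set.Icc 0 1) := by
    intro v hv
    refine ⟨fun j => v j.succ, ⟨fun j => simplex_ge hv _, fun j => simplex_le hv _⟩, ?_⟩
    ext i
    refine Fin.cases ?_ (fun j => ?_) i
    · have := hv.2.2.2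
      rw [Fin.sum_univ_succ] at this
      simp [baseE, secLin]; linarith
    · simp [baseE, secLin]
  refine (measure_mono hsub).trans_lt ?_
  refine (hlip.hausdorffMeasure_image_le (by positivity) _).trans_lt ?_
  refine ENNReal.mul_lt_top (ENNReal.rpow_lt_top_of_nonneg (by positivity) ENNReal.coe_ne_top) ?_
  have : (μH[(m + 2 : ℝ)] : Measure (Fin (m+2) → ℝ)) = volume := by
    rw [← hausdorffMeasure_pi_real]; simp
  rw [this]
  exact isCompact_Icc.measure_lt_top

lemma simplex_pos (m : ℕ) : 0 < μH[(m + 2 : ℝ)] (selmerSimplexE m) := by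
  have hlip := (LinearMap.toContinuousLinearMap (projLin m)).lipschitz
  have h1 := hlip.hausdorffMeasure_image_le (d := (m+2:ℝ)) (by positivity) (selmerSimplexE m)
  have hvol : (μH[(m + 2 : ℝ)] : Measure (Fin (m+2) → ℝ)) = volume := by
    rw [← hausdorffMeasure_pi_real]; simp
  rw [hvol] at h1
  set g : (Fin (m+2) → ℝ) → (Fin (m+3) → ℝ) := fun y => Fin.cons (1 - ∑ i, y i) y with hg
  set O : Set (Fin (m+3) → ℝ) := {x | 0 < x 0 ∧ (∀ i j : Fin (m+3), i < j → x i < x j) ∧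
    x (Fin.last (m+2)) < x 0 + x 1} with hO
  have hgc : Continuous g := by
    refine continuous_pi fun i => ?_
    refine Fin.cases ?_ (fun j => ?_) i
    · simp only [hg, Fin.cons_zero]; fun_prop
    · simp only [hg, Fin.cons_succ]; fun_prop
  have hOo : IsOpen O := by
    simp only [hO, Set.setOf_and, Set.setOf_forall]
    refine IsOpen.inter (isOpen_lt (by fun_prop) (by fun_prop)) (IsOpen.inter ?_
      (isOpen_lt (by fun_prop) (by fun_prop)))
    refine isOpen_iInter_of_finite fun i => isOpen_iInter_of_finite fun j =>
      isOpen_iInter_of_finite fun _ => isOpen_lt (by fun_prop) (by fun_prop)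
  have hWo : IsOpen (g ⁻¹' O) := hOo.preimage hgc
  have hWn : (g ⁻¹' O).Nonempty := by
    set w : Fin (m+3) → ℝ := fun i => (m + 3 + 1 + (i:ℕ) : ℝ) with hw
    have hwp : ∀ i, 0 < w i := fun i => by simp only [hw]; positivity
    set T := ∑ i, w i with hT
    have hTp : 0 < T := Finset.sum_pos (fun i _ => hwp i) ⟨0, Finset.mem_univ _⟩
    have hgw : g (fun j => w j.succ / T) = fun i => w i / T := by
      funext i
      refine Fin.cases ?_ (fun j => ?_) i
      · simp only [hg, Fin.cons_zero]
        rw [← Finset.sum_div, eq_div_iff hTp.ne', sub_mul, div_mul_cancel₀ _ hTp.ne', one_mul,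
          hT, Fin.sum_univ_succ]
        ring
      · simp [hg]
    refine ⟨fun j => w j.succ / T, ?_⟩
    rw [Set.mem_preimage, hgw]
    refine ⟨div_pos (hwp 0) hTp, fun i j hij => ?_, ?_⟩
    · refine div_lt_div_of_pos_right ?_ hTp
      have : ((i:ℕ):ℝ) < (j:ℕ) := by exact_mod_cast hij
      simp only [hw]; linarith
    · rw [← add_div]
      refine div_lt_div_of_pos_right ?_ hTp
      simp [hw]; linarith
  have hsub : g ⁻¹' O ⊆ (LinearMap.toContinuousLinearMap (projLin m)) '' (selmerSimplexE m) := by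
    intro y hy
    obtain ⟨ha, hb, hc⟩ := hy
    refine ⟨WithLp.toLp 2 (g y), ⟨ha.le, fun i j hij => ?_, hc.le, ?_⟩, ?_⟩
    · rcases hij.eq_or_lt with h | h
      · rw [h]
      · exact (hb i j h).le
    · rw [Fin.sum_univ_succ]; simp [hg]
    · funext j; simp [projLin, hg]
  have h2 := (hWo.measure_pos (μ := volume) hWn).trans_le ((measure_mono hsub).trans h1)
  exact pos_iff_ne_zero.2 fun h0 => by rw [h0] at h2; simp at h2

lemma simplex_meas (m : ℕ) : MeasurableSet (selmerSimplexE m) := by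
  have : IsClosed (selmerSimplexE m) := by
    unfold selmerSimplexE
    simp only [Set.setOf_and, Set.setOf_forall]
    refine IsClosed.inter (isClosed_le (by fun_prop) (by fun_prop)) (IsClosed.inter ?_
      (IsClosed.inter (isClosed_le (by fun_prop) (by fun_prop))
        (isClosed_eq (by fun_prop) (by fun_prop))))
    exact isClosed_iInter fun i => isClosed_iInter fun j =>
      isClosed_iInter fun _ => isClosed_le (by fun_prop) (by fun_prop)
  exact this.measurableSet

lemma Q_lower {m : ℕ} (c : Fin (m+3) → ℝ) (hc : ∀ j, 0 < c j)
    {v : EuclideanSpace ℝ (Fin (m+3))} (hv : v ∈ selmerSimplexE m) :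
    (∑ j : Fin (m+2), c j.succ) / (2 * (m + 3 : ℝ)) ≤ ∑ j, c j * v j := by
  rw [Fin.sum_univ_succ (fun j => c j * v j)]
  have h0 : 0 ≤ c 0 * v 0 := mul_nonneg (hc 0).le hv.1
  have h1 : ∑ j : Fin (m+2), c j.succ * (1 / (2 * (m+3:ℝ))) ≤ ∑ j : Fin (m+2), c j.succ * v j.succ :=
    Finset.sum_le_sum fun j _ => mul_le_mul_of_nonneg_left (simplex_succ hv j) (hc _).le
  rw [← Finset.sum_mul, mul_one_div] at h1
  linarith

lemma Q_upper {m : ℕ} (c : Fin (m+3) → ℝ) (hc : ∀ j, 0 < c j)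
    {v : EuclideanSpace ℝ (Fin (m+3))} (hv : v ∈ selmerSimplexE m) :
    ∑ j, c j * v j ≤ c 0 * v 0 + ∑ j : Fin (m+2), c j.succ := by
  rw [Fin.sum_univ_succ (fun j => c j * v j)]
  gcongr with j
  exact mul_le_of_le_one_right (hc _).le (simplex_le hv _)

lemma tail_pos {m : ℕ} (c : Fin (m+3) → ℝ) (hc : ∀ j, 0 < c j) :
    0 < ∑ j : Fin (m+2), c j.succ :=
  Finset.sum_pos (fun i _ => hc _) ⟨0, Finset.mem_univ _⟩

lemma Q_pos {m : ℕ} (c : Fin (m+3) → ℝ) (hc : ∀ j, 0 < c j)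
    {v : EuclideanSpace ℝ (Fin (m+3))} (hv : v ∈ selmerSimplexE m) :
    0 < ∑ j, c j * v j :=
  lt_of_lt_of_le (div_pos (tail_pos c hc) (by positivity)) (Q_lower c hc hv)

lemma f_meas {m : ℕ} (c : Fin (m+3) → ℝ) :
    Measurable fun v : EuclideanSpace ℝ (Fin (m+3)) => ((∑ j, c j * v j) ^ (m + 3))⁻¹ := by
  have : Continuous fun v : EuclideanSpace ℝ (Fin (m+3)) => ((∑ j, c j * v j) ^ (m + 3)) := by
    fun_prop
  exact this.measurable.inv

lemma f_int {m : ℕ} (c : Fin (m+3) → ℝ) (hc : ∀ j, 0 < c j) :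
    IntegrableOn (fun v : EuclideanSpace ℝ (Fin (m+3)) => ((∑ j, c j * v j) ^ (m + 3))⁻¹)
      (selmerSimplexE m) μH[(m + 2 : ℝ)] := by
  refine Measure.integrableOn_of_bounded (simplex_finite m).ne (f_meas c).aestronglyMeasurable
    (M := (((∑ j : Fin (m+2), c j.succ) / (2 * (m + 3 : ℝ))) ^ (m+3))⁻¹) ?_
  refine (ae_restrict_iff' (simplex_meas m)).2 (Filter.Eventually.of_forall fun v hv => ?_)
  have hB := tail_pos c hc
  have := Q_lower c hc hv
  have hp := Q_pos c hc hv
  rw [Real.norm_of_nonneg (by positivity)]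
  gcongr

lemma f_total_pos {m : ℕ} (c : Fin (m+3) → ℝ) (hc : ∀ j, 0 < c j) :
    0 < ∫ v in selmerSimplexE m, ((∑ j, c j * v j) ^ (m + 3))⁻¹ ∂(μH[(m + 2 : ℝ)]) := by
  have hB := tail_pos c hc
  have hc0 := hc 0
  set M := ((c 0 + ∑ j : Fin (m+2), c j.succ) ^ (m+3))⁻¹ with hM
  have hMp : 0 < M := by positivity
  have h1 : ∫ v in selmerSimplexE m, M ∂(μH[(m + 2 : ℝ)]) ≤
      ∫ v in selmerSimplexE m, ((∑ j, c j * v j) ^ (m + 3))⁻¹ ∂(μH[(m + 2 : ℝ)]) := by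
    refine setIntegral_mono_on (integrableOn_const (simplex_finite m).ne) (f_int c hc)
      (simplex_meas m) fun v hv => ?_
    have hp := Q_pos c hc hv
    have hu := Q_upper c hc hv
    have : c 0 * v 0 ≤ c 0 := mul_le_of_le_one_right hc0.le (simplex_le hv 0)
    rw [hM]
    gcongr
    linarith
  refine lt_of_lt_of_le ?_ h1
  rw [setIntegral_const, smul_eq_mul]
  exact mul_pos (ENNReal.toReal_pos (simplex_pos m).ne' (simplex_finite m).ne) hMp

/-- Slab of the simplex. -/
def slab (m : ℕ) (r : ℝ) (k : ℕ) : Set (EuclideanSpace ℝ (Fin (m+3))) :=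
  {v ∈ selmerSimplexE m | k * r ≤ v 0 ∧ v 0 < (k + 1) * r}

/-- Translation direction. -/
noncomputable def dirE (m : ℕ) : EuclideanSpace ℝ (Fin (m+3)) :=
  WithLp.toLp 2 (Fin.cons 1 (fun _ => -(1 / (m + 2 : ℝ))))

lemma slab_meas (m : ℕ) (r : ℝ) (k : ℕ) : MeasurableSet (slab m r k) := by
  refine (simplex_meas m).inter (MeasurableSet.inter ?_ ?_)
  · have : IsClosed {v : EuclideanSpace ℝ (Fin (m+3)) | k * r ≤ v 0} :=
      isClosed_le (by fun_prop) (by fun_prop)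
    exact this.measurableSet
  · have : IsOpen {v : EuclideanSpace ℝ (Fin (m+3)) | v 0 < (k + 1) * r} :=
      isOpen_lt (by fun_prop) (by fun_prop)
    exact this.measurableSet

lemma slab_trans (m : ℕ) (r : ℝ) (k n : ℕ) (hr : 0 < r) (hkn : k < n)
    (hnr : n * r ≤ 1 / (4 * (m + 3 : ℝ))) (v : EuclideanSpace ℝ (Fin (m+3)))
    (hv : v ∈ slab m r 0) : v + (k * r) • dirE m ∈ slab m r k := by
  obtain ⟨hv, h0, h1⟩ := hv
  simp only [Nat.cast_zero, zero_mul, zero_add, one_mul] at h0 h1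
  have hk : (k:ℝ) + 1 ≤ n := by exact_mod_cast hkn
  have e0 : (v + (k * r) • dirE m) 0 = v 0 + k * r := by simp [dirE]
  have es : ∀ j : Fin (m+2), (v + (k * r) • dirE m) j.succ = v j.succ - k * r * (1 / (m+2:ℝ)) := by
    intro j; simp [dirE]; ring
  have hkr : 0 ≤ k * r := by positivity
  have hkr1 : (k+1) * r ≤ n * r := by gcongr
  have hq : k * r * (1 / (m+2:ℝ)) ≤ k * r := by
    refine mul_le_of_le_one_right hkr ?_
    rw [div_le_one (by positivity)]
    have : (0:ℝ) ≤ m := by positivity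
    linarith
  have hhalf : 1 / (2 * (m + 3 : ℝ)) = 2 * (1 / (4 * (m+3:ℝ))) := by
    field_simp; norm_num
  refine ⟨⟨?_, ?_, ?_, ?_⟩, ?_, ?_⟩
  · rw [e0]; linarith
  · intro i j
    refine Fin.cases ?_ (fun i => ?_) i <;> refine Fin.cases ?_ (fun j => ?_) j
    · intro _; exact le_rfl
    · intro _
      rw [e0, es]
      have := simplex_succ hv j
      linarith
    · intro h; exact absurd h (by rw [Fin.le_def]; simp)
    · intro h
      rw [es, es]
      have := hv.2.1 _ _ h
      linarith
  · have hl : Fin.last (m+2) = (Fin.last (m+1)).succ := by simp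
    have h1' : (1 : Fin (m+3)) = (0 : Fin (m+2)).succ := by simp
    have := hv.2.2.1
    rw [hl, h1'] at this ⊢
    rw [es, es, e0]; linarith
  · rw [Fin.sum_univ_succ, e0]
    simp only [es]
    have := hv.2.2.2
    rw [Fin.sum_univ_succ] at this
    rw [Finset.sum_sub_distrib]
    simp only [Finset.sum_const, Finset.card_univ, Fintype.card_fin, nsmul_eq_mul]
    have : ((m+2:ℕ):ℝ) * (k * r * (1 / (m+2:ℝ))) = k * r := by
      push_cast; field_simp
    linarith
  · rw [e0]; linarith
  · rw [e0]; linarith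

lemma slab_bound (m : ℕ) (c : Fin (m+3) → ℝ) (hc : ∀ j, 0 < c j) (X : ℝ) (hX : ∀ j, c j ≤ X)
    (n : ℕ) (hn : 0 < n) (r : ℝ)
    (hr : r = (∑ j : Fin (m+2), c j.succ) / (4 * (m+3:ℝ)^2 * n * X)) :
    n * ∫ v in slab m r 0, ((∑ j, c j * v j) ^ (m + 3))⁻¹ ∂(μH[(m + 2 : ℝ)]) ≤
      2 ^ (m+3) * ∫ v in selmerSimplexE m, ((∑ j, c j * v j) ^ (m + 3))⁻¹ ∂(μH[(m + 2 : ℝ)]) := by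
  set f := fun v : EuclideanSpace ℝ (Fin (m+3)) => ((∑ j, c j * v j) ^ (m + 3))⁻¹ with hf
  set B := ∑ j : Fin (m+2), c j.succ with hBd
  have hB : 0 < B := tail_pos c hc
  have hXp : 0 < X := (hc 0).trans_le (hX 0)
  have hn' : (0:ℝ) < n := by exact_mod_cast hn
  have hrp : 0 < r := by rw [hr]; positivity
  have hBX : B ≤ (m+3) * X := by
    calc B ≤ ∑ j : Fin (m+2), X := Finset.sum_le_sum fun j _ => hX _
      _ = (m+2) * X := by simp
      _ ≤ _ := by gcongr; norm_num
  have hnrX : n * r * X = B / (4 * (m+3:ℝ)^2) := by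
    rw [hr]; field_simp
  have hnr : n * r ≤ 1 / (4 * (m+3:ℝ)) := by
    have : n * r = B / (4 * (m+3:ℝ)^2 * X) := by rw [hr]; field_simp
    rw [this, div_le_div_iff₀ (by positivity) (by positivity)]
    have hm : (0:ℝ) < 4 * (m+3) := by positivity
    nlinarith [mul_le_mul_of_nonneg_left hBX hm.le]
  have hfi : IntegrableOn f (selmerSimplexE m) μH[(m + 2 : ℝ)] := f_int c hc
  have hsub : ∀ k, slab m r k ⊆ selmerSimplexE m := fun k v hv => hv.1
  have hfn : ∀ v ∈ selmerSimplexE m, 0 ≤ f v := fun v hv => by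
    have := Q_pos c hc hv
    simp only [hf]; positivity
  have hk : ∀ k ∈ Finset.range n, ∫ v in slab m r 0, f v ∂(μH[(m + 2 : ℝ)]) ≤
      2^(m+3) * ∫ v in slab m r k, f v ∂(μH[(m + 2 : ℝ)]) := by
    intro k hkn
    have hkn := Finset.mem_range.1 hkn
    set e : EuclideanSpace ℝ (Fin (m+3)) ≃ᵢ EuclideanSpace ℝ (Fin (m+3)) :=
      IsometryEquiv.addRight ((k * r) • dirE m) with he
    have hmp := e.measurePreserving_hausdorffMeasure (m+2:ℝ)
    have himg : e '' slab m r 0 ⊆ slab m r k := by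
      rintro _ ⟨v, hv, rfl⟩
      exact slab_trans m r k n hrp hkn hnr v hv
    have hemb : MeasurableEmbedding e := e.toHomeomorph.measurableEmbedding
    have h1 : ∫ v in e '' slab m r 0, f v ∂(μH[(m + 2 : ℝ)]) =
        ∫ v in slab m r 0, f (e v) ∂(μH[(m + 2 : ℝ)]) := hmp.setIntegral_image_emb hemb f _
    have h2 : ∫ v in e '' slab m r 0, f v ∂(μH[(m + 2 : ℝ)]) ≤
        ∫ v in slab m r k, f v ∂(μH[(m + 2 : ℝ)]) := by
      refine setIntegral_mono_set (hfi.mono_set (hsub k)) ?_ (Filter.Eventually.of_forall himg)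
      exact (ae_restrict_iff' (slab_meas m r k)).2
        (Filter.Eventually.of_forall fun v hv => hfn v hv.1)
    have hint : IntegrableOn (fun v => f (e v)) (slab m r 0) μH[(m + 2 : ℝ)] := by
      have := (hmp.integrableOn_image hemb (f := f) (s := slab m r 0)).1
        (hfi.mono_set (himg.trans (hsub k)))
      exact this
    have h3 : ∫ v in slab m r 0, f v ∂(μH[(m + 2 : ℝ)]) ≤
        ∫ v in slab m r 0, 2^(m+3) * f (e v) ∂(μH[(m + 2 : ℝ)]) := by
      refine setIntegral_mono_on (hfi.mono_set (hsub 0)) (hint.const_mul _) (slab_meas m r 0)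
        fun v hv => ?_
      have hev : e v ∈ slab m r k := himg ⟨v, hv, rfl⟩
      have p1 := Q_pos c hc hv.1
      have p2 := Q_pos c hc hev.1
      have l1 := Q_lower c hc hv.1
      have hQ : ∑ j, c j * (e v) j ≤ 2 * ∑ j, c j * v j := by
        have hd : ∑ j, c j * (e v) j ≤ ∑ j, c j * v j + c 0 * (k * r) := by
          rw [Fin.sum_univ_succ, Fin.sum_univ_succ (fun j => c j * v j)]
          have e0 : (e v) 0 = v 0 + k * r := by simp [he, dirE]
          have es : ∀ j : Fin (m+2), (e v) j.succ ≤ v j.succ := by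
            intro j
            have : 0 ≤ k * r * (m+2:ℝ)⁻¹ := by positivity
            simp [he, dirE]; linarith
          have : ∑ j : Fin (m+2), c j.succ * (e v) j.succ ≤ ∑ j : Fin (m+2), c j.succ * v j.succ :=
            Finset.sum_le_sum fun j _ => mul_le_mul_of_nonneg_left (es j) (hc _).le
          rw [e0]; linarith
        have h5 : c 0 * (k * r) ≤ n * r * X := by
          have : (k:ℝ) ≤ n := by exact_mod_cast hkn.le
          calc c 0 * (k * r) ≤ X * (n * r) := by gcongr; exact hX 0
            _ = _ := by ring
        have h6 : B / (4 * (m+3:ℝ)^2) ≤ B / (2 * (m+3:ℝ)) := by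
          have : (0:ℝ) ≤ m := by positivity
          refine div_le_div_of_nonneg_left hB.le (by positivity) ?_
          nlinarith
        linarith
      simp only [hf]
      rw [← div_eq_mul_inv, inv_eq_one_div, div_le_div_iff₀ (by positivity) (by positivity), one_mul,
        ← mul_pow]
      gcongr
    rw [integral_const_mul] at h3
    refine h3.trans ?_
    rw [← h1]
    gcongr
  have hsum : ∑ k ∈ Finset.range n, ∫ v in slab m r k, f v ∂(μH[(m + 2 : ℝ)]) ≤
      ∫ v in selmerSimplexE m, f v ∂(μH[(m + 2 : ℝ)]) := by
    rw [← integral_biUnion_finset (Finset.range n) (fun k _ => slab_meas m r k) ?_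
      (fun k _ => hfi.mono_set (hsub k))]
    · refine setIntegral_mono_set hfi ?_
        (Filter.Eventually.of_forall (Set.iUnion₂_subset fun k _ => hsub k))
      exact (ae_restrict_iff' (simplex_meas m)).2 (Filter.Eventually.of_forall hfn)
    · intro a _ b _ hab
      refine Set.disjoint_left.2 fun v hva hvb => hab ?_
      obtain ⟨_, a1, a2⟩ := hva
      obtain ⟨_, b1, b2⟩ := hvb
      have h1 : (a:ℝ) < b + 1 := lt_of_mul_lt_mul_right (a1.trans_lt b2) hrp.le
      have h2 : (b:ℝ) < a + 1 := lt_of_mul_lt_mul_right (b1.trans_lt a2) hrp.le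
      have h1' : a < b + 1 := by exact_mod_cast h1
      have h2' : b < a + 1 := by exact_mod_cast h2
      omega
  calc n * ∫ v in slab m r 0, f v ∂(μH[(m + 2 : ℝ)])
      = ∑ k ∈ Finset.range n, ∫ v in slab m r 0, f v ∂(μH[(m + 2 : ℝ)]) := by simp
    _ ≤ ∑ k ∈ Finset.range n, 2^(m+3) * ∫ v in slab m r k, f v ∂(μH[(m + 2 : ℝ)]) :=
        Finset.sum_le_sum hk
    _ = 2^(m+3) * ∑ k ∈ Finset.range n, ∫ v in slab m r k, f v ∂(μH[(m + 2 : ℝ)]) := by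
        rw [Finset.mul_sum]
    _ ≤ _ := by gcongr


/-- For every `η ∈ (0,1)` and `ε > 0` there exists `L > 0` such that, regardless of the
past matrix `N` (any finite product of `B₁` and `B₂`, including the identity), with
conditional probability at least `η` the first coordinate drops below `ε` times its
initial value before the largest column sum increases by a factor of `L`. -/
theorem selmer_first_coordinate_decay (m : ℕ) (η : ℝ) (hη0 : 0 < η) (hη1 : η < 1)
    (ε : ℝ) (hε : 0 < ε) :
    ∃ L : ℝ, 0 < L ∧ ∀ N ∈ Submonoid.closure {selmerB1 m, selmerB2 m},
      η ≤ selmerCondP m N {v ∈ selmerSimplexE m | ∃ i : ℕ,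
        ((selmerS m)^[i] v) 0 < ε * v 0 ∧
        colMax m (N * selmerMat m v i) ≤ L * colMax m N} := by
  obtain ⟨n, hn⟩ := exists_nat_gt (2 ^ (m+3) / (1 - η))
  have hη' : 0 < 1 - η := by linarith
  have hn0 : (0:ℝ) < n := lt_of_le_of_lt (by positivity) hn
  have hnpos : 0 < n := by exact_mod_cast hn0
  set K : ℝ := 1 + 4 * (m+3:ℝ)^2 * n with hK
  have hKp : 0 < K := by positivity
  refine ⟨1 + 3 * K / ε, by positivity, fun N hN => ?_⟩
  have hc := colSum_pos_of_mem m N hN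
  set X := colMax m N with hXd
  have hX : ∀ j, colSum m N j ≤ X := colSum_le_max m N
  have hXp : 0 < X := (hc 0).trans_le (hX 0)
  set c := colSum m N with hcd
  set r := (∑ j : Fin (m+2), c j.succ) / (4 * (m+3:ℝ)^2 * n * X) with hr
  have hsb := slab_bound m c hc X hX n hnpos r hr
  have hD := f_total_pos c hc
  have hfi := f_int c hc
  unfold selmerCondP
  rw [le_div_iff₀ hD]
  set f := fun v : EuclideanSpace ℝ (Fin (m+3)) => ((∑ j, c j * v j) ^ (m + 3))⁻¹ with hf
  have hfn : ∀ v ∈ selmerSimplexE m, 0 ≤ f v := fun v hv => by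
    have := Q_pos c hc hv
    simp only [hf]; positivity
  set U := {v ∈ selmerSimplexE m | ∃ i : ℕ,
        ((selmerS m)^[i] v) 0 < ε * v 0 ∧
        colMax m (N * selmerMat m v i) ≤ (1 + 3 * K / ε) * X} with hU
  have hsub : selmerSimplexE m \ slab m r 0 ⊆ U := by
    rintro v ⟨hv, hns⟩
    refine ⟨hv, ?_⟩
    have hrv : r ≤ v 0 := by
      by_contra! h
      exact hns ⟨hv, by simpa using hv.1, by simpa using h⟩
    have hB := tail_pos c hc
    have hrp : 0 < r := by rw [hr]; positivity
    refine good_subset m N hc ε K hε hKp v ⟨hv.1, hv.2.1, hv.2.2.1⟩ (hrp.trans_le hrv) ?_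
    have hu := Q_upper c hc hv
    have h1 : (∑ j : Fin (m+2), c j.succ) ≤ 4 * (m+3:ℝ)^2 * n * X * v 0 := by
      rw [hr, div_le_iff₀ (by positivity)] at hrv
      linarith
    have h2 : c 0 * v 0 ≤ X * v 0 := mul_le_mul_of_nonneg_right (hX 0) hv.1
    rw [hK]
    calc ∑ j, c j * v j ≤ X * v 0 + 4 * (m+3:ℝ)^2 * n * X * v 0 := by linarith
      _ = _ := by ring
  have hmono : ∫ v in selmerSimplexE m \ slab m r 0, f v ∂(μH[(m + 2 : ℝ)]) ≤
      ∫ v in U, f v ∂(μH[(m + 2 : ℝ)]) := by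
    refine setIntegral_mono_set (hfi.mono_set fun v hv => hv.1) ?_
      (Filter.Eventually.of_forall hsub)
    exact ae_restrict_of_ae_restrict_of_subset (fun v hv => hv.1)
      ((ae_restrict_iff' (simplex_meas m)).2 (Filter.Eventually.of_forall hfn))
  have hdiff := setIntegral_sdiff (μ := μH[(m + 2 : ℝ)]) (slab_meas m r 0) hfi
    (fun v hv => hv.1)
  rw [hdiff] at hmono
  refine le_trans ?_ hmono
  have h2 : 2 ^ (m+3) < n * (1 - η) := by rwa [div_lt_iff₀ hη'] at hn
  set D := ∫ v in selmerSimplexE m, f v ∂(μH[(m + 2 : ℝ)]) with hDd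
  set T := ∫ v in slab m r 0, f v ∂(μH[(m + 2 : ℝ)]) with hTd
  have h3 : n * T ≤ n * ((1 - η) * D) := by
    refine hsb.trans ?_
    rw [← mul_assoc]
    exact mul_le_mul_of_nonneg_right h2.le hD.le
  have h4 := le_of_mul_le_mul_left h3 hn0
  linarith
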